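/- Let V : ℝⁿ → ℝ ∪ {+∞} be a convex lower semicontinuous function such that Z := ∫ e^{-V(x)} dx ∈ (0,∞), let η be the probability measure with density Z⁻¹ e^{-V} with respect to Lebesgue measure, and let ν = (∇V)#η be its moment measure. Then V* ∈ L¹(ν), V ∈ L¹(η), and the identity −log(∫ e^{-V(x)} dx) = −∫ V* dν + 𝒯(ν, η) + H(η) holds. -/

import Mathlib

open MeasureTheory Real Set
open scoped ENNReal InnerProductSpace

noncomputable section

variable {E : Type*} [NormedAddCommGroup E] [InnerProductSpace ℝ E]

/-- `exp (-t)` for an extended-real `t`, with the convention that it is `0` at `⊤`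
(proper functions never take the value `⊥`; we also set the value at `⊥` to `0`). -/
def expNeg (t : EReal) : ℝ := if t = ⊤ then 0 else if t = ⊥ then 0 else Real.exp (-t.toReal)

/-- Convexity for extended-real-valued functions. -/
def ConvexEReal (f : E → EReal) : Prop :=
  ∀ x y : E, ∀ a b : ℝ, 0 ≤ a → 0 ≤ b → a + b = 1 →
    f (a • x + b • y) ≤ (a : EReal) * f x + (b : EReal) * f y

/-- The class `𝓕` of proper convex lower semicontinuous functions `E → ℝ ∪ {+∞}`. -/
def IsProperConvexLSC (f : E → EReal) : Prop :=
  ConvexEReal f ∧ LowerSemicontinuous f ∧ (∀ x, f x ≠ ⊥) ∧ (∃ x, f x ≠ ⊤)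

/-- Fenchel-Legendre transform of an extended-real-valued function. -/
def fenchel (f : E → EReal) (y : E) : EReal := ⨆ x : E, (⟪x, y⟫_ℝ : EReal) - f x

/-- positive part of an extended real, as `ℝ≥0∞`. -/
def ERealPos (t : EReal) : ℝ≥0∞ := if t = ⊤ then ⊤ else ENNReal.ofReal t.toReal

/-- Integral of an extended-real-valued function, with value in `EReal`. -/
def eintegral {α : Type*} [MeasurableSpace α] (μ : Measure α) (g : α → EReal) : EReal :=
  ((∫⁻ x, ERealPos (g x) ∂μ : ℝ≥0∞) : EReal) - ((∫⁻ x, ERealPos (-(g x)) ∂μ : ℝ≥0∞) : EReal)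

/-- An extended-real-valued function belongs to `L¹(μ)` : it is `μ`-a.e. finite and its
real part is integrable. -/
def MemL1 {α : Type*} [MeasurableSpace α] (μ : Measure α) (g : α → EReal) : Prop :=
  (∀ᵐ x ∂μ, g x ≠ ⊤ ∧ g x ≠ ⊥) ∧ Integrable (fun x => (g x).toReal) μ

variable [MeasurableSpace E]

/-- The maximal correlation transport cost `𝒯(μ₁, μ₂)`. -/
def mcCost (μ₁ μ₂ : Measure E) : EReal :=
  ⨅ f : {f : E → EReal // IsProperConvexLSC f},
    eintegral μ₁ f.1 + eintegral μ₂ (fenchel f.1)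

/-- Relative entropy with respect to the Lebesgue measure. -/
def relEnt {n : ℕ} (μ : Measure (EuclideanSpace ℝ (Fin n))) : ℝ :=
  ∫ x, Real.log ((μ.rnDeriv volume x).toReal) ∂μ

section ExtendedConvex

variable {F : Type*} [NormedAddCommGroup F] [InnerProductSpace ℝ F]

theorem ConvexEReal.convexOn_toReal {f : F → EReal} (hf : ConvexEReal f) (hbot : ∀ x, f x ≠ ⊥) :
    ConvexOn ℝ {x | f x ≠ ⊤} (fun x => (f x).toReal) := by
  have key : ∀ x, f x ≠ ⊤ → ∀ y, f y ≠ ⊤ → ∀ a b : ℝ, 0 ≤ a → 0 ≤ b → a + b = 1 →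
      f (a • x + b • y) ≤ ((a * (f x).toReal + b * (f y).toReal : ℝ) : EReal) := by
    intro x hx y hy a b ha hb hab
    have h := hf x y a b ha hb hab
    rw [← EReal.coe_toReal hx (hbot x), ← EReal.coe_toReal hy (hbot y)] at h
    exact_mod_cast h
  refine ⟨?_, ?_⟩
  · intro x hx y hy a b ha hb hab
    exact ne_top_of_le_ne_top (EReal.coe_ne_top _) (key x hx y hy a b ha hb hab)
  · intro x hx y hy a b ha hb hab
    have h := key x hx y hy a b ha hb hab
    have h' := EReal.toReal_le_toReal h (hbot _) (EReal.coe_ne_top _)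
    rwa [EReal.toReal_coe] at h'

/-- A proper convex lower semicontinuous function has a continuous affine minorant. -/
theorem IsProperConvexLSC.exists_affine_le [CompleteSpace F] {f : F → EReal}
    (hf : IsProperConvexLSC f) :
    ∃ (a : F) (b : ℝ), ∀ x, ((⟪a, x⟫_ℝ + b : ℝ) : EReal) ≤ f x := by
  obtain ⟨hconv, hlsc, hbot, x₀, hx₀⟩ := hf
  set A : Set (F × ℝ) := {p | f p.1 ≤ (p.2 : EReal)} with hA
  have hAclosed : IsClosed A :=
    hlsc.isClosed_epigraph.preimage
      (continuous_fst.prodMk (continuous_coe_real_ereal.comp continuous_snd))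
  have hAconv : Convex ℝ A := by
    have := (hconv.convexOn_toReal hbot).convex_epigraph
    convert this using 1
    ext p
    simp only [hA, Set.mem_ofPred_eq]
    constructor
    · intro h
      have hp : f p.1 ≠ ⊤ := ne_top_of_le_ne_top (EReal.coe_ne_top _) h
      exact ⟨hp, by simpa using EReal.toReal_le_toReal h (hbot _) (EReal.coe_ne_top _)⟩
    · rintro ⟨hp, h⟩
      rw [← EReal.coe_toReal hp (hbot _)]
      exact_mod_cast h
  have hnot : ((x₀, (f x₀).toReal - 1) : F × ℝ) ∉ A := by
    simp only [hA, Set.mem_ofPred_eq]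
    rw [← EReal.coe_toReal hx₀ (hbot _), EReal.coe_le_coe_iff]
    simp
  obtain ⟨L, u, h₁, h₂⟩ := geometric_hahn_banach_point_closed hAconv hAclosed hnot
  have hL : ∀ (x : F) (t : ℝ), L (x, t) = L (x, 0) + t * L (0, 1) := by
    intro x t
    have : ((x, t) : F × ℝ) = (x, 0) + t • (0, 1) := by simp
    rw [this, map_add, map_smul, smul_eq_mul]
  have hx₀A : L (x₀, (f x₀).toReal - 1) < L (x₀, (f x₀).toReal) := by
    refine h₁.trans (h₂ _ ?_)
    simp [hA, EReal.coe_toReal hx₀ (hbot _)]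
  set c := L (0, 1) with hc
  have hcpos : 0 < c := by
    rw [hL, hL x₀ (f x₀).toReal] at hx₀A
    nlinarith
  set ℓ : StrongDual ℝ F := L.comp (ContinuousLinearMap.inl ℝ F ℝ) with hℓ
  refine ⟨-(c⁻¹ • (InnerProductSpace.toDual ℝ F).symm ℓ), u / c, fun x => ?_⟩
  rw [inner_neg_left, real_inner_smul_left, InnerProductSpace.toDual_symm_apply]
  by_cases hx : f x = ⊤
  · simp [hx]
  · rw [← EReal.coe_toReal hx (hbot _), EReal.coe_le_coe_iff]
    have h := h₂ (x, (f x).toReal) (by simp [hA, EReal.coe_toReal hx (hbot _)])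
    rw [hL] at h
    have : ℓ x = L (x, 0) := rfl
    rw [this]
    have h3 : -(c⁻¹ * L (x, 0)) + u / c = (u - L (x, 0)) / c := by field_simp; ring
    rw [h3, div_le_iff₀ hcpos]
    linarith

theorem ConvexOn.add_inner_le_of_hasGradientAt [CompleteSpace F] {D : Set F} {v : F → ℝ}
    (hv : ConvexOn ℝ D v) {x g z : F} (hx : x ∈ D) (hz : z ∈ D) (hg : HasGradientAt v g x) :
    v x + ⟪g, z - x⟫_ℝ ≤ v z := by
  have hline : HasDerivAt (fun t : ℝ => v (AffineMap.lineMap x z t)) ⟪g, z - x⟫_ℝ 0 := by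
    have h1 : HasDerivAt (fun t : ℝ => (AffineMap.lineMap x z t : F)) (z - x) 0 :=
      AffineMap.hasDerivAt_lineMap
    have h2 : HasFDerivAt v (InnerProductSpace.toDual ℝ F g)
        ((AffineMap.lineMap x z : ℝ → F) 0) := by
      simpa using hg.hasFDerivAt
    exact h2.comp_hasDerivAt (0 : ℝ) h1
  have hslope := hline.tendsto_slope_zero_right
  have hev : ∀ᶠ t : ℝ in nhdsWithin 0 (Set.Ioi 0),
      t⁻¹ • (v (AffineMap.lineMap x z (0 + t)) - v (AffineMap.lineMap x z (0 : ℝ))) ≤ v z - v x := by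
    filter_upwards [Ioo_mem_nhdsGT (show (0 : ℝ) < 1 by norm_num)] with t ht
    have := hv.2 hx hz (sub_nonneg.2 ht.2.le) ht.1.le (by ring)
    rw [← AffineMap.lineMap_apply_module] at this
    simp only [zero_add, AffineMap.lineMap_apply_zero, smul_eq_mul] at this ⊢
    rw [inv_mul_le_iff₀ ht.1]
    linarith
  have := le_of_tendsto hslope hev
  linarith

variable {f : F → EReal}

theorem le_fenchel (f : F → EReal) (x y : F) : (⟪x, y⟫_ℝ : EReal) - f x ≤ fenchel f y :=
  le_iSup (fun x : F => (⟪x, y⟫_ℝ : EReal) - f x) x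

theorem fenchel_ne_bot (hbot : ∀ x, f x ≠ ⊥) (htop : ∃ x, f x ≠ ⊤) (y : F) :
    fenchel f y ≠ ⊥ := by
  obtain ⟨x, hx⟩ := htop
  refine ne_bot_of_le_ne_bot ?_ (le_fenchel f x y)
  rw [← EReal.coe_toReal hx (hbot x), ← EReal.coe_sub]
  exact EReal.coe_ne_bot _

theorem fenchel_le_iff (hbot : ∀ x, f x ≠ ⊥) (y : F) (c : EReal) :
    fenchel f y ≤ c ↔ ∀ x, f x ≠ ⊤ → ((⟪x, y⟫_ℝ - (f x).toReal : ℝ) : EReal) ≤ c := by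
  rw [fenchel, iSup_le_iff]
  refine forall_congr' fun x => ?_
  by_cases hx : f x = ⊤
  · simp [hx]
  · simp only [ne_eq, hx, not_false_eq_true, forall_const]
    rw [EReal.coe_sub, EReal.coe_toReal hx (hbot x)]

theorem lowerSemicontinuous_fenchel (hbot : ∀ x, f x ≠ ⊥) :
    LowerSemicontinuous (fenchel f) := by
  refine lowerSemicontinuous_iSup fun x => ?_
  by_cases hx : f x = ⊤
  · simp [hx, lowerSemicontinuous_const]
  · have : (fun y : F => (⟪x, y⟫_ℝ : EReal) - f x)
        = fun y => ((⟪x, y⟫_ℝ - (f x).toReal : ℝ) : EReal) := by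
      funext y
      rw [EReal.coe_sub, EReal.coe_toReal hx (hbot x)]
    rw [this]
    exact (continuous_coe_real_ereal.comp (by fun_prop)).lowerSemicontinuous

theorem convexEReal_fenchel (hbot : ∀ x, f x ≠ ⊥) : ConvexEReal (fenchel f) := by
  intro y z a b ha hb hab
  rw [fenchel_le_iff hbot]
  intro x hx
  have hle : ∀ w, ((⟪x, w⟫_ℝ - (f x).toReal : ℝ) : EReal) ≤ fenchel f w :=
    fun w => (fenchel_le_iff hbot w _).1 le_rfl x hx
  have hsplit : ⟪x, a • y + b • z⟫_ℝ - (f x).toReal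
      = a * (⟪x, y⟫_ℝ - (f x).toReal) + b * (⟪x, z⟫_ℝ - (f x).toReal) := by
    rw [inner_add_right, real_inner_smul_right, real_inner_smul_right]
    linear_combination (f x).toReal * hab
  rw [hsplit, EReal.coe_add, EReal.coe_mul, EReal.coe_mul]
  exact add_le_add (mul_le_mul_of_nonneg_left (hle y) (EReal.coe_nonneg.2 ha))
    (mul_le_mul_of_nonneg_left (hle z) (EReal.coe_nonneg.2 hb))

theorem fenchel_fenchel_le (hbot : ∀ x, f x ≠ ⊥) (x : F) : fenchel (fenchel f) x ≤ f x := by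
  by_cases hx : f x = ⊤
  · simp [hx]
  refine iSup_le fun y => ?_
  have h := (fenchel_le_iff hbot y _).1 le_rfl x hx
  calc (⟪y, x⟫_ℝ : EReal) - fenchel f y
      ≤ (⟪y, x⟫_ℝ : EReal) - ((⟪x, y⟫_ℝ - (f x).toReal : ℝ) : EReal) := EReal.sub_le_sub le_rfl h
    _ = f x := by
      rw [← EReal.coe_sub, real_inner_comm, sub_sub_cancel, EReal.coe_toReal hx (hbot x)]

theorem fenchel_eq_of_subgradient (hbot : ∀ x, f x ≠ ⊥) {x g : F} (hx : f x ≠ ⊤)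
    (hsub : ∀ z, f z ≠ ⊤ → (f x).toReal + ⟪g, z - x⟫_ℝ ≤ (f z).toReal) :
    fenchel f g = ((⟪x, g⟫_ℝ - (f x).toReal : ℝ) : EReal) := by
  refine le_antisymm ((fenchel_le_iff hbot g _).2 fun z hz => ?_)
    ((fenchel_le_iff hbot g _).1 le_rfl x hx)
  have h := hsub z hz
  rw [inner_sub_right, real_inner_comm, real_inner_comm x g] at h
  rw [EReal.coe_le_coe_iff]
  linarith

theorem inner_le_add_fenchel {f : F → EReal} (hbot : ∀ x, f x ≠ ⊥) (htop : ∃ x, f x ≠ ⊤)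
    (x y : F) (hx : f x ≠ ⊤) (hy : fenchel f y ≠ ⊤) :
    ⟪x, y⟫_ℝ ≤ (f x).toReal + (fenchel f y).toReal := by
  have h := (fenchel_le_iff hbot y _).1 le_rfl x hx
  rw [← EReal.coe_toReal hy (fenchel_ne_bot hbot htop y), EReal.coe_le_coe_iff] at h
  linarith

end ExtendedConvex

section EIntegral

variable {α : Type*} [MeasurableSpace α] {μ : Measure α} {g : α → EReal}

theorem ERealPos_mono {s t : EReal} (h : s ≤ t) : ERealPos s ≤ ERealPos t := by
  unfold ERealPos
  by_cases ht : t = ⊤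
  · simp [ht]
  · have hs : s ≠ ⊤ := ne_top_of_le_ne_top ht h
    simp only [ht, hs, if_false]
    by_cases hsb : s = ⊥
    · simp [hsb]
    · exact ENNReal.ofReal_le_ofReal (EReal.toReal_le_toReal h hsb ht)

theorem ERealPos_coe (t : ℝ) : ERealPos (t : EReal) = ENNReal.ofReal t := by
  simp [ERealPos]

theorem measurable_ERealPos : Measurable ERealPos :=
  Measurable.ite (measurableSet_singleton _) measurable_const
    (ENNReal.measurable_ofReal.comp measurable_ereal_toReal)

theorem eintegral_mono {g h : α → EReal} (hgh : ∀ x, g x ≤ h x) :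
    eintegral μ g ≤ eintegral μ h :=
  EReal.sub_le_sub
    (EReal.coe_ennreal_le_coe_ennreal_iff.2 (lintegral_mono fun x => ERealPos_mono (hgh x)))
    (EReal.coe_ennreal_le_coe_ennreal_iff.2
      (lintegral_mono fun x => ERealPos_mono (EReal.neg_le_neg_iff.2 (hgh x))))

theorem eintegral_map {β : Type*} [MeasurableSpace β] {T : β → α} {ρ : Measure β}
    (hT : Measurable T) (hg : Measurable g) :
    eintegral (Measure.map T ρ) g = eintegral ρ (fun x => g (T x)) := by
  have h1 := lintegral_map (μ := ρ) (measurable_ERealPos.comp hg) hT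
  have h2 := lintegral_map (μ := ρ) (measurable_ERealPos.comp hg.neg) hT
  simp only [Function.comp_apply, Pi.neg_apply] at h1 h2
  rw [eintegral, h1, h2, eintegral]

theorem eintegral_eq_integral (hg : MemL1 μ g) :
    eintegral μ g = ((∫ x, (g x).toReal ∂μ : ℝ) : EReal) := by
  have hpos : ∫⁻ x, ERealPos (g x) ∂μ = ∫⁻ x, ENNReal.ofReal (g x).toReal ∂μ :=
    lintegral_congr_ae <| hg.1.mono fun x hx => by simp [ERealPos, hx.1]
  have hneg : ∫⁻ x, ERealPos (-(g x)) ∂μ = ∫⁻ x, ENNReal.ofReal (-(g x).toReal) ∂μ :=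
    lintegral_congr_ae <| hg.1.mono fun x hx => by simp [ERealPos, hx.2]
  have h1 : ∫⁻ x, ENNReal.ofReal (g x).toReal ∂μ ≠ ⊤ := hg.2.lintegral_lt_top.ne
  have h2 : ∫⁻ x, ENNReal.ofReal (-(g x).toReal) ∂μ ≠ ⊤ := hg.2.neg.lintegral_lt_top.ne
  rw [eintegral, hpos, hneg, integral_eq_lintegral_pos_part_sub_lintegral_neg_part hg.2,
    EReal.coe_sub, EReal.coe_ennreal_toReal h1, EReal.coe_ennreal_toReal h2]

theorem eintegral_eq_top_or_memL1 (hg : AEMeasurable g μ) (hbot : ∀ x, g x ≠ ⊥) {a : α → ℝ}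
    (ha : Integrable a μ) (hag : ∀ᵐ x ∂μ, (a x : EReal) ≤ g x) :
    eintegral μ g = ⊤ ∨ MemL1 μ g := by
  have hneg : ∫⁻ x, ERealPos (-(g x)) ∂μ < ⊤ := by
    refine lt_of_le_of_lt (lintegral_mono_ae ?_) ha.neg.lintegral_lt_top
    filter_upwards [hag] with x hx
    rw [Pi.neg_apply, ← ERealPos_coe, EReal.coe_neg]
    exact ERealPos_mono (EReal.neg_le_neg_iff.2 hx)
  by_cases hpos : ∫⁻ x, ERealPos (g x) ∂μ = ⊤
  · left
    rw [eintegral, hpos, ← EReal.coe_ennreal_toReal hneg.ne]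
    simp
  · right
    have hfin : ∀ᵐ x ∂μ, g x ≠ ⊤ := by
      filter_upwards [ae_lt_top' (measurable_ERealPos.comp_aemeasurable hg) hpos] with x hx htop
      simp [ERealPos, htop] at hx
    refine ⟨hfin.mono fun x hx => ⟨hx, hbot x⟩, ?_⟩
    have hmeas : AEStronglyMeasurable (fun x => (g x).toReal) μ :=
      hg.ereal_toReal.aestronglyMeasurable
    refine ⟨hmeas, ?_⟩
    rw [hasFiniteIntegral_iff_norm]
    have hle : ∫⁻ x, ENNReal.ofReal ‖(g x).toReal‖ ∂μ
        ≤ ∫⁻ x, (ERealPos (g x) + ERealPos (-(g x))) ∂μ := by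
      refine lintegral_mono_ae (hfin.mono fun x hx => ?_)
      have h1 : ERealPos (g x) = ENNReal.ofReal (g x).toReal := by simp [ERealPos, hx]
      have h2 : ERealPos (-(g x)) = ENNReal.ofReal (-(g x).toReal) := by
        simp [ERealPos, hbot x]
      rw [h1, h2, Real.norm_eq_abs]
      rcases le_total 0 (g x).toReal with h | h
      · rw [abs_of_nonneg h]; exact le_self_add
      · rw [abs_of_nonpos h]; exact le_add_self
    refine hle.trans_lt ?_
    have hadd := lintegral_add_left' (measurable_ERealPos.comp_aemeasurable hg)
      (fun x => ERealPos (-(g x)))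
    simp only [Function.comp_apply] at hadd
    rw [hadd]
    exact ENNReal.add_lt_top.2 ⟨lt_top_iff_ne_top.2 hpos, hneg⟩

theorem MemL1.eintegral_ne_bot (hg : MemL1 μ g) : eintegral μ g ≠ ⊥ := by
  rw [eintegral_eq_integral hg]
  exact EReal.coe_ne_bot _

theorem integral_le_eintegral_add {g h : α → EReal} (hg : AEMeasurable g μ)
    (hh : AEMeasurable h μ) (hgbot : ∀ x, g x ≠ ⊥) (hhbot : ∀ x, h x ≠ ⊥) {a b c : α → ℝ}
    (ha : Integrable a μ) (hag : ∀ᵐ x ∂μ, (a x : EReal) ≤ g x)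
    (hb : Integrable b μ) (hbh : ∀ᵐ x ∂μ, (b x : EReal) ≤ h x) (hc : Integrable c μ)
    (hle : ∀ x, g x ≠ ⊤ → h x ≠ ⊤ → c x ≤ (g x).toReal + (h x).toReal) :
    ((∫ x, c x ∂μ : ℝ) : EReal) ≤ eintegral μ g + eintegral μ h := by
  rcases eintegral_eq_top_or_memL1 hg hgbot ha hag with hg' | hg'
  · rcases eintegral_eq_top_or_memL1 hh hhbot hb hbh with hh' | hh'
    · simp [hg', hh']
    · rw [hg', EReal.top_add_of_ne_bot hh'.eintegral_ne_bot]
      exact le_top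
  · rcases eintegral_eq_top_or_memL1 hh hhbot hb hbh with hh' | hh'
    · rw [hh', EReal.add_top_of_ne_bot hg'.eintegral_ne_bot]
      exact le_top
    · rw [eintegral_eq_integral hg', eintegral_eq_integral hh', ← EReal.coe_add,
        EReal.coe_le_coe_iff, ← integral_add hg'.2 hh'.2]
      refine integral_mono_ae hc (hg'.2.add hh'.2) ?_
      filter_upwards [hg'.1, hh'.1] with x h1 h2
      exact hle x h1.1 h2.1

end EIntegral

section ExpNeg

theorem expNeg_top : expNeg ⊤ = 0 := by simp [expNeg]

theorem expNeg_of_ne {t : EReal} (h₁ : t ≠ ⊤) (h₂ : t ≠ ⊥) : expNeg t = Real.exp (-t.toReal) := by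
  simp [expNeg, h₁, h₂]

theorem expNeg_nonneg (t : EReal) : 0 ≤ expNeg t := by
  unfold expNeg
  split_ifs <;> positivity

theorem exp_neg_le_expNeg {t : EReal} {c : ℝ} (hbot : t ≠ ⊥) (h : t ≤ c) :
    Real.exp (-c) ≤ expNeg t := by
  have htop : t ≠ ⊤ := ne_top_of_le_ne_top (EReal.coe_ne_top _) h
  rw [expNeg_of_ne htop hbot, Real.exp_le_exp, neg_le_neg_iff]
  simpa using EReal.toReal_le_toReal h hbot (EReal.coe_ne_top _)

theorem measurable_expNeg : Measurable expNeg :=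
  Measurable.ite (measurableSet_singleton _) measurable_const
    (Measurable.ite (measurableSet_singleton _) measurable_const
      (Real.measurable_exp.comp measurable_ereal_toReal.neg))

end ExpNeg

section LogConcave

variable [BorelSpace E] [FiniteDimensional ℝ E] {μ : Measure E} [μ.IsAddHaarMeasure]
  {V : E → EReal}

/-- A convex function whose Gibbs weight is not negligible is bounded above on some ball. -/
theorem ConvexEReal.exists_ball_le (hV : ConvexEReal V) (hbot : ∀ x, V x ≠ ⊥)
    (hpos : 0 < ∫ x, expNeg (V x) ∂μ) :
    ∃ (x₀ : E) (r : ℝ) (c : ℝ), 0 < r ∧ ∀ z ∈ Metric.ball x₀ r, V z ≤ c := by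
  have hex : ∃ k : ℕ, μ {x | V x ≤ ((k : ℝ) : EReal)} ≠ 0 := by
    by_contra! h
    have hunion : μ (⋃ k : ℕ, {x | V x ≤ ((k : ℝ) : EReal)}) = 0 := measure_iUnion_null h
    have hzero : (fun x => expNeg (V x)) =ᵐ[μ] 0 := by
      filter_upwards [measure_eq_zero_iff_ae_notMem.1 hunion] with x hx
      have htop : V x = ⊤ := by
        by_contra hne
        obtain ⟨k, hk⟩ := exists_nat_ge (V x).toReal
        refine hx (Set.mem_iUnion.2 ⟨k, ?_⟩)
        rw [Set.mem_ofPred_eq, ← EReal.coe_toReal hne (hbot x)]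
        exact_mod_cast hk
      simp [htop, expNeg_top]
    rw [integral_congr_ae hzero] at hpos
    simp at hpos
  obtain ⟨k, hk⟩ := hex
  set A := {x | V x ≤ ((k : ℝ) : EReal)} with hA
  have hconv : Convex ℝ A := by
    intro x hx y hy a b ha hb hab
    calc V (a • x + b • y) ≤ (a : EReal) * V x + (b : EReal) * V y := hV x y a b ha hb hab
      _ ≤ (a : EReal) * ((k : ℝ) : EReal) + (b : EReal) * ((k : ℝ) : EReal) :=
        add_le_add (mul_le_mul_of_nonneg_left hx (EReal.coe_nonneg.2 ha))
          (mul_le_mul_of_nonneg_left hy (EReal.coe_nonneg.2 hb))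
      _ = ((k : ℝ) : EReal) := by
        rw [← EReal.coe_mul, ← EReal.coe_mul, ← EReal.coe_add, ← add_mul, hab, one_mul]
  have hint : (interior A).Nonempty := by
    by_contra h
    rw [Set.not_nonempty_iff_eq_empty] at h
    refine hk (measure_mono_null ?_ (hconv.addHaar_frontier μ))
    rw [frontier, h, Set.sdiff_empty]
    exact subset_closure
  obtain ⟨x₀, hx₀⟩ := hint
  obtain ⟨r, hr, hball⟩ := Metric.isOpen_iff.1 isOpen_interior x₀ hx₀
  refine ⟨x₀, r, k, hr, fun z hz => ?_⟩
  have hzA : z ∈ A := interior_subset (hball hz)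
  exact hzA

/-- Averaging over a ball where `V` is bounded above controls `V` from below. -/
theorem ConvexEReal.exp_mul_le_setIntegral (hV : ConvexEReal V) (hbot : ∀ x, V x ≠ ⊥)
    (hint : Integrable (fun x => expNeg (V x)) μ) {x₀ : E} {r c : ℝ}
    (hball : ∀ z ∈ Metric.ball x₀ r, V z ≤ c) {x : E} (hx : V x ≠ ⊤) :
    Real.exp (-(((V x).toReal + c) / 2)) * μ.real (Metric.ball (0 : E) (r / 2))
      ≤ ∫ p in Metric.ball ((2 : ℝ)⁻¹ • (x + x₀)) (r / 2), expNeg (V p) ∂μ := by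
  have hvol : μ.real (Metric.ball (0 : E) (r / 2))
      = μ.real (Metric.ball ((2 : ℝ)⁻¹ • (x + x₀)) (r / 2)) := by
    rw [measureReal_def, measureReal_def, Measure.addHaar_ball_center μ ((2 : ℝ)⁻¹ • (x + x₀))]
  rw [hvol, mul_comm, ← smul_eq_mul, ← setIntegral_const]
  refine setIntegral_mono_on (integrableOn_const (by finiteness)) hint.integrableOn
    measurableSet_ball fun p hp => ?_
  refine exp_neg_le_expNeg (hbot p) ?_
  set z : E := (2 : ℝ) • p - x with hz
  have hzball : z ∈ Metric.ball x₀ r := by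
    rw [Metric.mem_ball, dist_eq_norm] at hp ⊢
    have : z - x₀ = (2 : ℝ) • (p - (2 : ℝ)⁻¹ • (x + x₀)) := by
      rw [smul_sub, smul_smul, hz]; norm_num; abel
    rw [this, norm_smul, Real.norm_two]
    linarith
  have hp' : p = (2 : ℝ)⁻¹ • x + (2 : ℝ)⁻¹ • z := by
    rw [hz, smul_sub, smul_smul]; norm_num
  have h := hV x z 2⁻¹ 2⁻¹ (by norm_num) (by norm_num) (by norm_num)
  rw [← hp'] at h
  refine h.trans ?_
  have hhalf : (0 : EReal) ≤ ((2⁻¹ : ℝ) : EReal) := EReal.coe_nonneg.2 (by norm_num)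
  refine (add_le_add le_rfl (mul_le_mul_of_nonneg_left (hball z hzball) hhalf)).trans ?_
  rw [← EReal.coe_toReal hx (hbot x), ← EReal.coe_mul, ← EReal.coe_mul, ← EReal.coe_add,
    EReal.coe_le_coe_iff, EReal.toReal_coe]
  exact le_of_eq (by ring)

/-- Convex functions with integrable Gibbs weight grow at least linearly. -/
theorem ConvexEReal.exists_norm_le (hV : ConvexEReal V) (hbot : ∀ x, V x ≠ ⊥)
    (hint : Integrable (fun x => expNeg (V x)) μ) (hpos : 0 < ∫ x, expNeg (V x) ∂μ) :
    ∃ a b : ℝ, 0 < a ∧ ∀ x, V x ≠ ⊤ → a * ‖x‖ - b ≤ (V x).toReal := by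
  obtain ⟨x₀, r, c, hr, hball⟩ := hV.exists_ball_le hbot hpos
  have hx₀ : V x₀ ≤ c := hball x₀ (Metric.mem_ball_self hr)
  have hx₀top : V x₀ ≠ ⊤ := ne_top_of_le_ne_top (EReal.coe_ne_top _) hx₀
  have hx₀real : (V x₀).toReal ≤ c := by
    simpa using EReal.toReal_le_toReal hx₀ (hbot _) (EReal.coe_ne_top _)
  set Z := ∫ x, expNeg (V x) ∂μ with hZ
  set β := μ.real (Metric.ball (0 : E) (r / 2)) with hβ
  have hβpos : 0 < β :=
    ENNReal.toReal_pos (Metric.measure_ball_pos μ _ (by positivity)).ne' measure_ball_lt_top.ne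
  have hlow : ∀ x, V x ≠ ⊤ → -2 * Real.log (Z / β) - c ≤ (V x).toReal := by
    intro x hx
    have h := (hV.exp_mul_le_setIntegral hbot hint hball hx).trans
      (setIntegral_le_integral hint (Filter.Eventually.of_forall fun p => expNeg_nonneg (V p)))
    rw [← le_div_iff₀ hβpos, ← Real.le_log_iff_exp_le (by positivity)] at h
    linarith
  have htail : Filter.Tendsto (fun k : ℕ => ∫ p in (Metric.closedBall (0 : E) k)ᶜ, expNeg (V p) ∂μ)
      Filter.atTop (nhds 0) := by
    have hanti : Antitone fun k : ℕ => (Metric.closedBall (0 : E) k)ᶜ := fun i j hij =>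
      Set.compl_subset_compl.2 (Metric.closedBall_subset_closedBall (by exact_mod_cast hij))
    have h := tendsto_setIntegral_of_antitone (μ := μ) (f := fun p => expNeg (V p))
      (fun k : ℕ => Metric.isClosed_closedBall.measurableSet.compl) hanti
      ⟨0, hint.integrableOn⟩
    have hempty : ⋂ k : ℕ, (Metric.closedBall (0 : E) k)ᶜ = ∅ := by
      rw [← Set.compl_iUnion, Metric.iUnion_closedBall_nat, Set.compl_univ]
    rw [hempty] at h
    simpa using h
  obtain ⟨k, hk⟩ := (htail.eventually (gt_mem_nhds
    (show (0 : ℝ) < Real.exp (-((c + 1 + c) / 2)) * β by positivity))).exists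
  have hfar : ∀ x, V x ≠ ⊤ → 2 * k + ‖x₀‖ + r ≤ ‖x‖ → c + 1 ≤ (V x).toReal := by
    intro x hx hxn
    have h := (hV.exp_mul_le_setIntegral hbot hint hball hx)
    have hsub : Metric.ball ((2 : ℝ)⁻¹ • (x + x₀)) (r / 2) ⊆ (Metric.closedBall (0 : E) k)ᶜ := by
      intro p hp
      rw [Metric.mem_ball, dist_eq_norm] at hp
      rw [Set.mem_compl_iff, mem_closedBall_zero_iff, not_le]
      have h1 : ‖x + x₀‖ ≤ 2 * ‖p‖ + 2 * ‖p - (2 : ℝ)⁻¹ • (x + x₀)‖ := by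
        have : x + x₀ = (2 : ℝ) • p - (2 : ℝ) • (p - (2 : ℝ)⁻¹ • (x + x₀)) := by
          rw [smul_sub, smul_smul]; norm_num
        calc ‖x + x₀‖ = ‖(2 : ℝ) • p - (2 : ℝ) • (p - (2 : ℝ)⁻¹ • (x + x₀))‖ := by rw [← this]
          _ ≤ _ := (norm_sub_le _ _).trans (by rw [norm_smul, norm_smul]; norm_num)
      have h2 : ‖x‖ ≤ ‖x + x₀‖ + ‖x₀‖ := by
        simpa using norm_sub_le (x + x₀) x₀
      linarith
    have h' := h.trans_lt ((setIntegral_mono_set hint.integrableOn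
      (Filter.Eventually.of_forall fun p => expNeg_nonneg (V p)) hsub.eventuallyLE).trans_lt hk)
    have h'' := Real.exp_lt_exp.1 (lt_of_mul_lt_mul_right h' hβpos.le)
    linarith
  set R := 2 * k + ‖x₀‖ + r + ‖x₀‖ with hR
  have hRpos : 0 < R := by positivity
  refine ⟨R⁻¹, |-2 * Real.log (Z / β) - c| + |c| + 1 + R⁻¹ * ‖x₀‖, by positivity, fun x hx => ?_⟩
  have hxx₀ : ‖x‖ ≤ ‖x - x₀‖ + ‖x₀‖ := by simpa using norm_add_le (x - x₀) x₀
  have hmul : R⁻¹ * ‖x‖ ≤ R⁻¹ * ‖x - x₀‖ + R⁻¹ * ‖x₀‖ := by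
    rw [← mul_add]; gcongr
  rcases lt_or_ge ‖x - x₀‖ R with hlt | hge
  · have h1 : R⁻¹ * ‖x - x₀‖ ≤ 1 := by
      rw [inv_mul_le_iff₀ hRpos]; linarith
    have h2 := hlow x hx
    have h3 := neg_abs_le (-2 * Real.log (Z / β) - c)
    have h4 := abs_nonneg c
    linarith
  · set t := R / ‖x - x₀‖ with ht
    have hnpos : 0 < ‖x - x₀‖ := hRpos.trans_le hge
    have htpos : 0 < t := by positivity
    have ht1 : t ≤ 1 := (div_le_one hnpos).2 hge
    have hcv := hV.convexOn_toReal hbot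
    set y := (1 - t) • x₀ + t • x with hy
    have hytop : V y ≠ ⊤ := hcv.1 hx₀top hx (sub_nonneg.2 ht1) htpos.le (by ring)
    have hyx₀ : ‖y - x₀‖ = R := by
      have : y - x₀ = t • (x - x₀) := by rw [hy]; module
      rw [this, norm_smul, Real.norm_of_nonneg htpos.le, ht, div_mul_cancel₀ _ hnpos.ne']
    have hyn : 2 * k + ‖x₀‖ + r ≤ ‖y‖ := by
      have : ‖y - x₀‖ ≤ ‖y‖ + ‖x₀‖ := norm_sub_le _ _
      linarith
    have h1 := hfar y hytop hyn
    have h2 := hcv.2 hx₀top hx (sub_nonneg.2 ht1) htpos.le (by ring)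
    simp only [smul_eq_mul] at h2
    rw [← hy] at h2
    have h3 : (1 - t) * (V x₀).toReal ≤ (1 - t) * c :=
      mul_le_mul_of_nonneg_left hx₀real (sub_nonneg.2 ht1)
    have h4 : t * c + 1 ≤ t * (V x).toReal := by linarith
    have h5 : c + R⁻¹ * ‖x - x₀‖ ≤ (V x).toReal := by
      have : t * (c + R⁻¹ * ‖x - x₀‖) ≤ t * (V x).toReal := by
        have : t * (c + R⁻¹ * ‖x - x₀‖) = t * c + 1 := by
          rw [ht]; field_simp
        rw [this]; exact h4
      exact le_of_mul_le_mul_left this htpos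
    have h6 := neg_abs_le c
    have h7 := abs_nonneg (-2 * Real.log (Z / β) - c)
    linarith

theorem integrable_comp_homothety {w : E → ℝ} (hw : Integrable w μ) (z : E) {s : ℝ} (hs : s ≠ 0) :
    Integrable (fun x => w (z + s • (x - z))) μ :=
  ((hw.comp_add_left z).comp_smul hs).comp_sub_right z

theorem integral_comp_homothety (w : E → ℝ) (z : E) {s : ℝ} (hs : 0 ≤ s) :
    ∫ x, w (z + s • (x - z)) ∂μ = (s ^ Module.finrank ℝ E)⁻¹ * ∫ x, w x ∂μ := by
  rw [integral_sub_right_eq_self (fun x => w (z + s • x)) z,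
    Measure.integral_comp_smul_of_nonneg μ (fun x => w (z + x)) s (hR := hs),
    integral_add_left_eq_self, smul_eq_mul]

/-- The potential of a log-concave weight is integrable against the weight. -/
theorem ConvexEReal.integrable_expNeg_mul_toReal (hV : ConvexEReal V) (hbot : ∀ x, V x ≠ ⊥)
    (hmeas : Measurable V) (hint : Integrable (fun x => expNeg (V x)) μ)
    (hpos : 0 < ∫ x, expNeg (V x) ∂μ) :
    Integrable (fun x => expNeg (V x) * (V x).toReal) μ := by
  obtain ⟨x₀, r, c, hr, hball⟩ := hV.exists_ball_le hbot hpos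
  obtain ⟨a, b, ha, hab⟩ := hV.exists_norm_le hbot hint hpos
  have hx₀ : V x₀ ≤ c := hball x₀ (Metric.mem_ball_self hr)
  have hx₀top : V x₀ ≠ ⊤ := ne_top_of_le_ne_top (EReal.coe_ne_top _) hx₀
  have hx₀real : (V x₀).toReal ≤ c := by
    simpa using EReal.toReal_le_toReal hx₀ (hbot _) (EReal.coe_ne_top _)
  have hscale := integrable_comp_homothety hint x₀ (show (2⁻¹ : ℝ) ≠ 0 by norm_num)
  refine Integrable.mono'
    ((hscale.const_mul (2 * Real.exp (b / 2) * Real.exp (c / 2))).add (hint.mul_const |b|))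
    ((measurable_expNeg.comp hmeas).mul hmeas.ereal_toReal).aestronglyMeasurable
    (Filter.Eventually.of_forall fun x => ?_)
  simp only [Pi.add_apply]
  by_cases hx : V x = ⊤
  · have := expNeg_nonneg (V (x₀ + (2⁻¹ : ℝ) • (x - x₀)))
    simp only [hx, expNeg_top, zero_mul, norm_zero, add_zero]
    positivity
  have hcv := hV.convexOn_toReal hbot
  have hy : x₀ + (2⁻¹ : ℝ) • (x - x₀) = (2⁻¹ : ℝ) • x₀ + (2⁻¹ : ℝ) • x := by module
  rw [hy]
  set y := (2⁻¹ : ℝ) • x₀ + (2⁻¹ : ℝ) • x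
  have hytop : V y ≠ ⊤ := hcv.1 hx₀top hx (by norm_num) (by norm_num) (by norm_num)
  have h2 := hcv.2 hx₀top hx (show (0 : ℝ) ≤ 2⁻¹ by norm_num) (show (0 : ℝ) ≤ 2⁻¹ by norm_num)
    (by norm_num)
  simp only [smul_eq_mul] at h2
  change (V y).toReal ≤ _ at h2
  have hyV : (V y).toReal ≤ (c + (V x).toReal) / 2 := by linarith
  set v := (V x).toReal with hv
  have hlow : -b ≤ v := by
    have := hab x hx
    have : 0 ≤ a * ‖x‖ := by positivity
    linarith
  rw [expNeg_of_ne hx (hbot x), expNeg_of_ne hytop (hbot y), norm_mul,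
    Real.norm_of_nonneg (Real.exp_pos _).le, Real.norm_eq_abs, ← hv]
  have habs : |v| ≤ (v + b) + |b| := by
    calc |v| = |(v + b) - b| := by ring_nf
      _ ≤ |v + b| + |b| := abs_sub _ _
      _ = _ := by rw [abs_of_nonneg (by linarith)]
  have h3 : v + b ≤ 2 * Real.exp ((v + b) / 2) := by
    have := Real.add_one_le_exp ((v + b) / 2)
    linarith
  have h4 : Real.exp (-((c + v) / 2)) ≤ Real.exp (-(V y).toReal) :=
    Real.exp_le_exp.2 (neg_le_neg hyV)
  calc Real.exp (-v) * |v| ≤ Real.exp (-v) * (2 * Real.exp ((v + b) / 2) + |b|) := by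
        gcongr; linarith
    _ = 2 * Real.exp (b / 2) * Real.exp (c / 2) * Real.exp (-((c + v) / 2))
        + Real.exp (-v) * |b| := by
      have e1 : Real.exp (-v) * Real.exp ((v + b) / 2)
          = Real.exp (b / 2) * Real.exp (c / 2) * Real.exp (-((c + v) / 2)) := by
        rw [← Real.exp_add, ← Real.exp_add, ← Real.exp_add]; congr 1; ring
      linear_combination 2 * e1
    _ ≤ _ := by gcongr

end LogConcave

section Moment

/-- A function bounded below whose Laplace transform near `0` is at least affine is integrable. -/
theorem integrable_of_one_sub_mul_le_integral_exp {α : Type*} [MeasurableSpace α] {η : Measure α}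
    [IsProbabilityMeasure η] {φ : α → ℝ} (hφ : AEMeasurable φ η) {K d : ℝ} (hK : 0 ≤ K)
    (hlow : ∀ᵐ x ∂η, -K ≤ φ x)
    (hexp : ∀ s : ℝ, 0 < s → s ≤ 1 → 1 - d * s ≤ ∫ x, Real.exp (-(s * φ x)) ∂η) :
    Integrable φ η := by
  set C := K * Real.exp K with hC
  have hKC : K ≤ C := le_mul_of_one_le_right hK (Real.one_le_exp hK)
  set s : ℕ → ℝ := fun k => 1 / ((k : ℝ) + 1) with hs
  have hspos : ∀ k, 0 < s k := fun k => by positivity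
  have hs1 : ∀ k, s k ≤ 1 := fun k => by
    rw [hs, div_le_one (by positivity)]; linarith [(Nat.cast_nonneg k : (0 : ℝ) ≤ k)]
  set F : ℕ → α → ℝ := fun k x => (1 - Real.exp (-(s k * φ x))) / s k + C with hF
  have hintexp : ∀ k, Integrable (fun x => Real.exp (-(s k * φ x))) η := by
    intro k
    refine Integrable.of_bound
      (Real.measurable_exp.comp_aemeasurable (hφ.const_mul _).neg).aestronglyMeasurable
      (Real.exp K) ?_
    filter_upwards [hlow] with x hx
    rw [Real.norm_of_nonneg (Real.exp_pos _).le, Real.exp_le_exp]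
    nlinarith [hspos k, hs1 k]
  have hFint : ∀ k, Integrable (F k) η := fun k =>
    (((integrable_const 1).sub (hintexp k)).div_const _).add (integrable_const C)
  have hFnonneg : ∀ k, 0 ≤ᵐ[η] F k := by
    intro k
    filter_upwards [hlow] with x hx
    have h1 : Real.exp (-(s k * φ x)) ≤ Real.exp (s k * K) :=
      Real.exp_le_exp.2 (by nlinarith [hspos k])
    have h2 : Real.exp (s k * K) - 1 ≤ s k * C := by
      have h3 := Real.add_one_le_exp (-(s k * K))
      have h4 : Real.exp (s k * K) * Real.exp (-(s k * K)) = 1 := by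
        rw [← Real.exp_add]; simp
      have h5 : Real.exp (s k * K) ≤ Real.exp K :=
        Real.exp_le_exp.2 (mul_le_of_le_one_left hK (hs1 k))
      have h6 : Real.exp (s k * K) - 1 ≤ s k * K * Real.exp (s k * K) := by
        nlinarith [Real.exp_pos (s k * K)]
      have h7 : s k * K * Real.exp (s k * K) ≤ s k * K * Real.exp K :=
        mul_le_mul_of_nonneg_left h5 (mul_nonneg (hspos k).le hK)
      rw [hC]; linarith
    have h8 : -C ≤ (1 - Real.exp (-(s k * φ x))) / s k := by
      rw [le_div_iff₀ (hspos k)]; linarith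
    simp only [Pi.zero_apply, hF]
    linarith
  have hFle : ∀ k, ∫⁻ x, ENNReal.ofReal (F k x) ∂η ≤ ENNReal.ofReal (d + C) := by
    intro k
    rw [← ofReal_integral_eq_lintegral_ofReal (hFint k) (hFnonneg k)]
    refine ENNReal.ofReal_le_ofReal ?_
    have : ∫ x, F k x ∂η = (1 - ∫ x, Real.exp (-(s k * φ x)) ∂η) / s k + C := by
      have hsub : Integrable (fun x => 1 - Real.exp (-(s k * φ x))) η :=
        (integrable_const 1).sub (hintexp k)
      simp only [hF]
      rw [integral_add (hsub.div_const _) (integrable_const C), integral_div,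
        integral_sub (integrable_const 1) (hintexp k)]
      simp
    rw [this]
    have h1 := hexp (s k) (hspos k) (hs1 k)
    have h2 : (1 - ∫ x, Real.exp (-(s k * φ x)) ∂η) / s k ≤ d := by
      rw [div_le_iff₀ (hspos k)]; linarith
    linarith
  have hlim : ∀ x, Filter.Tendsto (fun k => ENNReal.ofReal (F k x)) Filter.atTop
      (nhds (ENNReal.ofReal (φ x + C))) := by
    intro x
    refine ENNReal.tendsto_ofReal (Filter.Tendsto.add_const C ?_)
    have hder : HasDerivAt (fun t : ℝ => -Real.exp (-(t * φ x))) (φ x) 0 := by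
      have h := (((hasDerivAt_id (0 : ℝ)).mul_const (φ x)).neg.exp).neg
      refine (h.congr_deriv ?_).congr_of_eventuallyEq (Filter.Eventually.of_forall fun t => rfl)
      simp
    have hst : Filter.Tendsto s Filter.atTop (nhdsWithin 0 (Set.Ioi 0)) :=
      tendsto_nhdsWithin_iff.2 ⟨tendsto_one_div_add_atTop_nhds_zero_nat,
        Filter.Eventually.of_forall hspos⟩
    have := hder.tendsto_slope_zero_right.comp hst
    refine this.congr fun k => ?_
    simp only [Function.comp_apply, zero_add, zero_mul, neg_zero, Real.exp_zero, smul_eq_mul]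
    field_simp
    ring
  have hFmeas : ∀ k, AEMeasurable (fun x => ENNReal.ofReal (F k x)) η := fun k =>
    (hFint k).aemeasurable.ennreal_ofReal
  have hbound : ∫⁻ x, ENNReal.ofReal (φ x + C) ∂η ≤ ENNReal.ofReal (d + C) := by
    calc ∫⁻ x, ENNReal.ofReal (φ x + C) ∂η
        = ∫⁻ x, Filter.liminf (fun k => ENNReal.ofReal (F k x)) Filter.atTop ∂η := by
          simp_rw [fun x => (hlim x).liminf_eq]
      _ ≤ Filter.liminf (fun k => ∫⁻ x, ENNReal.ofReal (F k x) ∂η) Filter.atTop :=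
          lintegral_liminf_le' hFmeas
      _ ≤ Filter.liminf (fun _ : ℕ => ENNReal.ofReal (d + C)) Filter.atTop :=
          Filter.liminf_le_liminf (Filter.Eventually.of_forall hFle)
      _ = ENNReal.ofReal (d + C) := Filter.liminf_const _
  have hintC : Integrable (fun x => φ x + C) η := by
    refine ⟨(hφ.add_const C).aestronglyMeasurable, ?_⟩
    rw [hasFiniteIntegral_iff_ofReal]
    · exact hbound.trans_lt ENNReal.ofReal_lt_top
    · filter_upwards [hlow] with x hx
      simp only [Pi.zero_apply]
      linarith
  exact (hintC.sub (integrable_const C)).congr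
    (Filter.Eventually.of_forall fun x => add_sub_cancel_right _ _)

end Moment

section Gibbs

variable {α : Type*} [MeasurableSpace α] {μ : Measure α} {V : α → EReal} {Z : ℝ} {η : Measure α}

theorem measurable_ofReal_expNeg_div (hmeas : Measurable V) (Z : ℝ) :
    Measurable fun x => ENNReal.ofReal (expNeg (V x) / Z) :=
  ((measurable_expNeg.comp hmeas).div_const Z).ennreal_ofReal

theorem ae_gibbs_iff (hmeas : Measurable V) (hbot : ∀ x, V x ≠ ⊥) (hZpos : 0 < Z)
    (hη : η = μ.withDensity (fun x => ENNReal.ofReal (expNeg (V x) / Z))) {p : α → Prop} :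
    (∀ᵐ x ∂η, p x) ↔ ∀ᵐ x ∂μ, V x ≠ ⊤ → p x := by
  rw [hη, ae_withDensity_iff (measurable_ofReal_expNeg_div hmeas Z)]
  refine Filter.eventually_congr (Filter.Eventually.of_forall fun x => ?_)
  by_cases hx : V x = ⊤
  · simp [hx, expNeg_top]
  · have : 0 < expNeg (V x) / Z := by
      rw [expNeg_of_ne hx (hbot x)]; positivity
    simp [hx, this]

theorem integrable_gibbs_iff (hmeas : Measurable V) (hZpos : 0 < Z)
    (hη : η = μ.withDensity (fun x => ENNReal.ofReal (expNeg (V x) / Z))) {h : α → ℝ} :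
    Integrable h η ↔ Integrable (fun x => expNeg (V x) * h x) μ := by
  rw [hη, integrable_withDensity_iff_integrable_smul'
    (measurable_ofReal_expNeg_div hmeas Z)
    (Filter.Eventually.of_forall fun _ => ENNReal.ofReal_lt_top)]
  have : (fun x => (ENNReal.ofReal (expNeg (V x) / Z)).toReal • h x)
      = fun x => Z⁻¹ * (expNeg (V x) * h x) := by
    funext x
    rw [ENNReal.toReal_ofReal (div_nonneg (expNeg_nonneg _) hZpos.le), smul_eq_mul]
    ring
  rw [this, integrable_const_mul_iff (isUnit_iff_ne_zero.2 (inv_ne_zero hZpos.ne'))]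

theorem integral_gibbs (hmeas : Measurable V) (hZpos : 0 < Z)
    (hη : η = μ.withDensity (fun x => ENNReal.ofReal (expNeg (V x) / Z))) (h : α → ℝ) :
    ∫ x, h x ∂η = Z⁻¹ * ∫ x, expNeg (V x) * h x ∂μ := by
  rw [hη, integral_withDensity_eq_integral_toReal_smul
    (measurable_ofReal_expNeg_div hmeas Z)
    (Filter.Eventually.of_forall fun _ => ENNReal.ofReal_lt_top), ← integral_const_mul]
  refine integral_congr_ae (Filter.Eventually.of_forall fun x => ?_)
  simp only
  rw [ENNReal.toReal_ofReal (div_nonneg (expNeg_nonneg _) hZpos.le), smul_eq_mul]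
  ring

theorem isProbabilityMeasure_gibbs (hint : Integrable (fun x => expNeg (V x)) μ)
    (hZ : Z = ∫ x, expNeg (V x) ∂μ) (hZpos : 0 < Z)
    (hη : η = μ.withDensity (fun x => ENNReal.ofReal (expNeg (V x) / Z))) :
    IsProbabilityMeasure η := by
  refine ⟨?_⟩
  rw [hη, withDensity_apply _ MeasurableSet.univ, Measure.restrict_univ,
    ← ofReal_integral_eq_lintegral_ofReal (hint.div_const Z)
      (Filter.Eventually.of_forall fun x => div_nonneg (expNeg_nonneg _) hZpos.le),
    integral_div, ← hZ, div_self hZpos.ne', ENNReal.ofReal_one]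

end Gibbs

section MomentMeasure

variable [BorelSpace E] [FiniteDimensional ℝ E] {μ : Measure E} [μ.IsAddHaarMeasure]
  {V : E → EReal} {Z : ℝ} {η : Measure E} {gV : E → E}

/-- The radial derivative of a convex potential about a point of its domain is integrable
against the Gibbs measure. -/
theorem ConvexEReal.integrable_inner_sub (hV : ConvexEReal V) (hbot : ∀ x, V x ≠ ⊥)
    (hmeas : Measurable V) (hint : Integrable (fun x => expNeg (V x)) μ)
    (hZ : Z = ∫ x, expNeg (V x) ∂μ) (hZpos : 0 < Z)
    (hη : η = μ.withDensity (fun x => ENNReal.ofReal (expNeg (V x) / Z)))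
    (hgVmeas : Measurable gV)
    (hgrad : ∀ᵐ x ∂η, HasGradientAt (fun y => (V y).toReal) (gV x) x) {z : E} (hz : V z ≠ ⊤) :
    Integrable (fun x => ⟪gV x, x - z⟫_ℝ) η := by
  have hprob := isProbabilityMeasure_gibbs hint hZ hZpos hη
  obtain ⟨a, b, ha, hab⟩ := hV.exists_norm_le hbot hint (hZ ▸ hZpos)
  have hcv := hV.convexOn_toReal hbot
  have hdom : ∀ᵐ x ∂η, V x ≠ ⊤ :=
    (ae_gibbs_iff hmeas hbot hZpos hη).2 (Filter.Eventually.of_forall fun _ h => h)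
  set φ : E → ℝ := fun x => ⟪gV x, x - z⟫_ℝ with hφ
  have hφmeas : Measurable φ := hgVmeas.inner (measurable_id.sub_const z)
  set K := |b| + |(V z).toReal| with hK
  have hlow : ∀ᵐ x ∂η, -K ≤ φ x := by
    filter_upwards [hgrad, hdom] with x hx hxdom
    have h1 := hcv.add_inner_le_of_hasGradientAt hxdom hz hx
    have h2 : ⟪gV x, z - x⟫_ℝ = -φ x := by rw [hφ, ← inner_neg_right, neg_sub]
    rw [h2] at h1
    have h3 := hab x hxdom
    have h4 : 0 ≤ a * ‖x‖ := by positivity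
    have h5 := le_abs_self b
    have h6 := le_abs_self (V z).toReal
    linarith
  refine integrable_of_one_sub_mul_le_integral_exp (d := Module.finrank ℝ E) hφmeas.aemeasurable
    (by positivity : 0 ≤ K) hlow fun s hs hs1 => ?_
  have hexpint : Integrable (fun x => Real.exp (-(s * φ x))) η := by
    refine Integrable.of_bound
      (Real.measurable_exp.comp (hφmeas.const_mul _).neg).aestronglyMeasurable (Real.exp K) ?_
    filter_upwards [hlow] with x hx
    rw [Real.norm_of_nonneg (Real.exp_pos _).le, Real.exp_le_exp]
    have : 0 ≤ K := by positivity
    nlinarith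
  rw [integral_gibbs hmeas hZpos hη]
  have hscale := integral_comp_homothety (μ := μ) (fun x => expNeg (V x)) z
    (show (0 : ℝ) ≤ 1 + s by linarith)
  have hle : ∫ x, expNeg (V (z + (1 + s) • (x - z))) ∂μ
      ≤ ∫ x, expNeg (V x) * Real.exp (-(s * φ x)) ∂μ := by
    refine integral_mono_ae (integrable_comp_homothety hint z (by positivity))
      ((integrable_gibbs_iff hmeas hZpos hη).1 hexpint) ?_
    filter_upwards [(ae_gibbs_iff hmeas hbot hZpos hη).1 hgrad] with x hx
    set y := z + (1 + s) • (x - z) with hy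
    by_cases hytop : V y = ⊤
    · rw [hytop, expNeg_top]
      exact mul_nonneg (expNeg_nonneg _) (Real.exp_pos _).le
    have hxy : x = (s / (1 + s)) • z + (1 / (1 + s)) • y := by
      have hs' : (1 + s) ≠ 0 := by positivity
      have h1 : (1 / (1 + s)) * (1 + s) = 1 := by field_simp
      have h2 : s / (1 + s) = 1 - 1 / (1 + s) := by field_simp; ring
      rw [hy, smul_add, smul_smul, h1, h2]
      module
    have hxdom : V x ≠ ⊤ := by
      rw [hxy]
      exact hcv.1 hz hytop (by positivity) (by positivity) (by field_simp; ring)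
    have h1 := hcv.add_inner_le_of_hasGradientAt hxdom hytop (hx hxdom)
    have h2 : ⟪gV x, y - x⟫_ℝ = s * φ x := by
      have : y - x = s • (x - z) := by rw [hy]; module
      rw [this, real_inner_smul_right]
    rw [h2] at h1
    rw [expNeg_of_ne hytop (hbot y), expNeg_of_ne hxdom (hbot x), ← Real.exp_add, Real.exp_le_exp]
    linarith
  rw [hscale, ← hZ] at hle
  have h1 : ((1 + s) ^ Module.finrank ℝ E)⁻¹
      ≤ Z⁻¹ * ∫ x, expNeg (V x) * Real.exp (-(s * φ x)) ∂μ := by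
    rw [← div_eq_inv_mul, le_div_iff₀ hZpos]
    exact hle
  refine le_trans ?_ h1
  have h2 := one_add_mul_le_pow (show (-2 : ℝ) ≤ -s by linarith) (Module.finrank ℝ E)
  have h3 : 1 - s ≤ (1 + s)⁻¹ := by
    rw [← one_div, le_div_iff₀ (by positivity)]; nlinarith
  have h4 : (1 + -s) ^ Module.finrank ℝ E ≤ ((1 + s)⁻¹) ^ Module.finrank ℝ E :=
    pow_le_pow_left₀ (by linarith) (by linarith) _
  rw [inv_pow] at h4
  linarith

/-- The moment measure of a log-concave measure has finite first moments. -/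
theorem ConvexEReal.integrable_inner_const (hV : ConvexEReal V) (hbot : ∀ x, V x ≠ ⊥)
    (hmeas : Measurable V) (hint : Integrable (fun x => expNeg (V x)) μ)
    (hZ : Z = ∫ x, expNeg (V x) ∂μ) (hZpos : 0 < Z)
    (hη : η = μ.withDensity (fun x => ENNReal.ofReal (expNeg (V x) / Z)))
    (hgVmeas : Measurable gV)
    (hgrad : ∀ᵐ x ∂η, HasGradientAt (fun y => (V y).toReal) (gV x) x) (u : E) :
    Integrable (fun x => ⟪gV x, u⟫_ℝ) η := by
  obtain ⟨x₀, r, c, hr, hball⟩ := hV.exists_ball_le hbot (hZ ▸ hZpos)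
  have hdom : ∀ z ∈ Metric.ball x₀ r, V z ≠ ⊤ := fun z hz =>
    ne_top_of_le_ne_top (EReal.coe_ne_top _) (hball z hz)
  set t := r / (2 * (‖u‖ + 1)) with ht
  have htpos : 0 < t := by positivity
  have hz : x₀ + t • u ∈ Metric.ball x₀ r := by
    rw [Metric.mem_ball, dist_eq_norm, add_sub_cancel_left, norm_smul,
      Real.norm_of_nonneg htpos.le, ht, div_mul_eq_mul_div, div_lt_iff₀ (by positivity)]
    nlinarith [norm_nonneg u]
  have h0 := hV.integrable_inner_sub hbot hmeas hint hZ hZpos hη hgVmeas hgrad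
    (hdom x₀ (Metric.mem_ball_self hr))
  have h1 := hV.integrable_inner_sub hbot hmeas hint hZ hZpos hη hgVmeas hgrad (hdom _ hz)
  refine ((h0.sub h1).const_mul t⁻¹).congr (Filter.Eventually.of_forall fun x => ?_)
  simp only [Pi.sub_apply]
  rw [← inner_sub_right, sub_sub_sub_cancel_left, add_sub_cancel_left, real_inner_smul_right,
    inv_mul_cancel_left₀ htpos.ne']

theorem ConvexEReal.integrable_id_gibbs (hV : ConvexEReal V) (hbot : ∀ x, V x ≠ ⊥)
    (hmeas : Measurable V) (hint : Integrable (fun x => expNeg (V x)) μ)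
    (hZ : Z = ∫ x, expNeg (V x) ∂μ) (hZpos : 0 < Z)
    (hη : η = μ.withDensity (fun x => ENNReal.ofReal (expNeg (V x) / Z))) :
    Integrable (fun x : E => x) η := by
  have hprob := isProbabilityMeasure_gibbs hint hZ hZpos hη
  obtain ⟨a, b, ha, hab⟩ := hV.exists_norm_le hbot hint (hZ ▸ hZpos)
  have hVint : Integrable (fun x => (V x).toReal) η := (integrable_gibbs_iff hmeas hZpos hη).2
    (hV.integrable_expNeg_mul_toReal hbot hmeas hint (hZ ▸ hZpos))
  refine Integrable.mono' ((hVint.add (integrable_const b)).const_mul a⁻¹)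
    measurable_id.aestronglyMeasurable ?_
  rw [ae_gibbs_iff hmeas hbot hZpos hη]
  refine Filter.Eventually.of_forall fun x hx => ?_
  have := hab x hx
  rw [← div_eq_inv_mul, le_div_iff₀ ha]
  simp only [Pi.add_apply]
  linarith

end MomentMeasure

/-- Lemma 2.1. Let `V : ℝⁿ → ℝ ∪ {+∞}` be convex lower semicontinuous
with `Z := ∫ e^{-V} dx ∈ (0,∞)`, let `η = Z⁻¹ e^{-V} dx` and let `ν = ∇V # η` be its
moment measure. Then `V* ∈ L¹(ν)`, `V ∈ L¹(η)` and
`-log ∫ e^{-V} dx = -∫ V* dν + 𝒯(ν,η) + H(η)`. -/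
theorem statement0 {n : ℕ} (V : EuclideanSpace ℝ (Fin n) → EReal)
    (hVconv : ConvexEReal V) (hVlsc : LowerSemicontinuous V) (hVbot : ∀ x, V x ≠ ⊥)
    (hVint : Integrable (fun x => expNeg (V x)) volume)
    (Z : ℝ) (hZ : Z = ∫ x, expNeg (V x)) (hZpos : 0 < Z)
    (η : Measure (EuclideanSpace ℝ (Fin n)))
    (hη : η = volume.withDensity (fun x => ENNReal.ofReal (expNeg (V x) / Z)))
    (gV : EuclideanSpace ℝ (Fin n) → EuclideanSpace ℝ (Fin n)) (hgVmeas : Measurable gV)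
    (hgrad : ∀ᵐ x ∂η, HasGradientAt (fun y => (V y).toReal) (gV x) x)
    (ν : Measure (EuclideanSpace ℝ (Fin n))) (hν : ν = Measure.map gV η) :
    MemL1 ν (fenchel V) ∧ MemL1 η V ∧
      ((- Real.log Z : ℝ) : EReal)
        = - eintegral ν (fenchel V) + mcCost ν η + ((relEnt η : ℝ) : EReal) := by
  have hmeas : Measurable V := hVlsc.measurable
  have hVpos : 0 < ∫ x, expNeg (V x) := hZ ▸ hZpos
  have hprob := isProbabilityMeasure_gibbs hVint hZ hZpos hη
  have hcv := hVconv.convexOn_toReal hVbot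
  have hdom : ∀ᵐ x ∂η, V x ≠ ⊤ :=
    (ae_gibbs_iff hmeas hVbot hZpos hη).2 (Filter.Eventually.of_forall fun _ h => h)
  have hVtop : ∃ x, V x ≠ ⊤ := hdom.exists
  have hVL1 : Integrable (fun x => (V x).toReal) η := (integrable_gibbs_iff hmeas hZpos hη).2
    (hVconv.integrable_expNeg_mul_toReal hVbot hmeas hVint hVpos)
  have hVmem : MemL1 η V := ⟨hdom.mono fun x hx => ⟨hx, hVbot x⟩, hVL1⟩
  have hconst := fun u => hVconv.integrable_inner_const hVbot hmeas hVint hZ hZpos hη hgVmeas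
    hgrad u
  have hinner : Integrable (fun x => ⟪gV x, x⟫_ℝ) η := by
    obtain ⟨z, hz⟩ := hVtop
    have h := hVconv.integrable_inner_sub hVbot hmeas hVint hZ hZpos hη hgVmeas hgrad hz
    refine (h.add (hconst z)).congr (Filter.Eventually.of_forall fun x => ?_)
    simp only [Pi.add_apply]
    rw [← inner_add_right, sub_add_cancel]
  have hfen : ∀ᵐ x ∂η, fenchel V (gV x) = ((⟪gV x, x⟫_ℝ - (V x).toReal : ℝ) : EReal) := by
    filter_upwards [hgrad, hdom] with x hx hxdom
    rw [fenchel_eq_of_subgradient hVbot hxdom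
      (fun z hz => hcv.add_inner_le_of_hasGradientAt hxdom hz hx), real_inner_comm]
  have hfenmeas : Measurable (fenchel V) := (lowerSemicontinuous_fenchel hVbot).measurable
  have hfenbot := fenchel_ne_bot hVbot hVtop
  have hfenmem' : MemL1 η (fun x => fenchel V (gV x)) := by
    refine ⟨hfen.mono fun x hx => ⟨?_, hfenbot _⟩, (hinner.sub hVL1).congr ?_⟩
    · exact ne_of_eq_of_ne hx (EReal.coe_ne_top _)
    · filter_upwards [hfen] with x hx
      rw [hx, EReal.toReal_coe, Pi.sub_apply]
  have hfenmem : MemL1 ν (fenchel V) := by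
    subst hν
    refine ⟨?_, (integrable_map_measure hfenmeas.ereal_toReal.aestronglyMeasurable
      hgVmeas.aemeasurable).2 hfenmem'.2⟩
    have hset : MeasurableSet {y | fenchel V y ≠ ⊤ ∧ fenchel V y ≠ ⊥} :=
      (hfenmeas (measurableSet_singleton _).compl).inter
        (hfenmeas (measurableSet_singleton _).compl)
    exact (ae_map_iff hgVmeas.aemeasurable hset).2 hfenmem'.1
  refine ⟨hfenmem, hVmem, ?_⟩
  have hfenint : eintegral ν (fenchel V)
      = ((∫ x, ⟪gV x, x⟫_ℝ ∂η - ∫ x, (V x).toReal ∂η : ℝ) : EReal) := by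
    rw [hν, eintegral_map hgVmeas hfenmeas, eintegral_eq_integral hfenmem',
      ← integral_sub hinner hVL1]
    congr 1
    refine integral_congr_ae ?_
    filter_upwards [hfen] with x hx
    rw [hx, EReal.toReal_coe]
  have hcost : mcCost ν η = ((∫ x, ⟪gV x, x⟫_ℝ ∂η : ℝ) : EReal) := by
    refine le_antisymm ?_ (le_iInf fun f => ?_)
    · have hfenproper : IsProperConvexLSC (fenchel V) :=
        ⟨convexEReal_fenchel hVbot, lowerSemicontinuous_fenchel hVbot, hfenbot,
          (hfenmem'.1.exists).imp' gV fun _ h => h.1⟩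
      refine (iInf_le _ ⟨fenchel V, hfenproper⟩).trans ?_
      calc eintegral ν (fenchel V) + eintegral η (fenchel (fenchel V))
          ≤ eintegral ν (fenchel V) + eintegral η V :=
            add_le_add le_rfl (eintegral_mono (fenchel_fenchel_le hVbot))
        _ = _ := by
            rw [hfenint, eintegral_eq_integral hVmem, ← EReal.coe_add, sub_add_cancel]
    · obtain ⟨f, hf⟩ := f
      obtain ⟨a, b, hab⟩ := hf.exists_affine_le
      obtain ⟨-, hflsc, hfbot, y₀, hy₀⟩ := hf
      rw [hν, eintegral_map hgVmeas hflsc.measurable]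
      refine integral_le_eintegral_add (hflsc.measurable.comp hgVmeas).aemeasurable
        (lowerSemicontinuous_fenchel hfbot).measurable.aemeasurable (fun x => hfbot _)
        (fenchel_ne_bot hfbot ⟨y₀, hy₀⟩) ((hconst a).add (integrable_const b))
        (Filter.Eventually.of_forall fun x => ?_)
        (((hVconv.integrable_id_gibbs hVbot hmeas hVint hZ hZpos hη).const_inner y₀).sub
          (integrable_const (f y₀).toReal))
        (Filter.Eventually.of_forall fun x => ?_) hinner
        (fun x => inner_le_add_fenchel hfbot ⟨y₀, hy₀⟩ (gV x) x)
      · simp only [Pi.add_apply]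
        rw [real_inner_comm]
        exact hab (gV x)
      · exact (fenchel_le_iff hfbot x _).1 le_rfl y₀ hy₀
  have hent : relEnt η = -(∫ x, (V x).toReal ∂η) - Real.log Z := by
    have hac : η ≪ volume := hη ▸ withDensity_absolutelyContinuous _ _
    have hrn : ∀ᵐ x ∂η, η.rnDeriv volume x = ENNReal.ofReal (expNeg (V x) / Z) :=
      hac.ae_le (hη ▸ Measure.rnDeriv_withDensity volume (measurable_ofReal_expNeg_div hmeas Z))
    have hlog : ∫ x, Real.log ((η.rnDeriv volume x).toReal) ∂η
        = ∫ x, (-(V x).toReal - Real.log Z) ∂η := by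
      refine integral_congr_ae ?_
      filter_upwards [hrn, hdom] with x hx hxdom
      rw [hx, ENNReal.toReal_ofReal (div_nonneg (expNeg_nonneg _) hZpos.le),
        expNeg_of_ne hxdom (hVbot x), Real.log_div (Real.exp_pos _).ne' hZpos.ne', Real.log_exp]
    have hneg : Integrable (fun x => -(V x).toReal) η := hVL1.neg
    rw [relEnt, hlog, integral_sub hneg (integrable_const _), integral_neg]
    simp
  rw [hfenint, hcost, hent, ← EReal.coe_neg, ← EReal.coe_add, ← EReal.coe_add,
    EReal.coe_eq_coe_iff]
  ring

end
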